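/- Suppose |V| = |R × S| and the linear map K_1 : ℂ^V → ℂ^{R×S} is invertible, and set C_p = min_{‖η‖_{ℓ^p} = 1} ‖K_1 η‖_{ℓ^p}. Let λ ≥ 1, and define R_λ = (1/μ_p) · C_p/(C_p + ν_p λ) and r_{p,λ} = R_λ · C_p · (1 − 1/λ). Then for every φ ∈ ℂ^{R×S} with ‖φ‖_{ℓ^p} < r_{p,λ}, there exists exactly one η ∈ ℂ^V with ‖η‖_{ℓ^p} < R_λ such that Σ_{j=1}^∞ K_j(η, …, η) = φ. -/

import Mathlib

open scoped ENNReal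

/-- The ℓ^p norm of a finitely indexed family, `p ∈ [1, ∞]`. -/
noncomputable def lpNorm (p : ℝ≥0∞) {ι E : Type*} [Fintype ι] [SeminormedAddCommGroup E]
    (f : ι → E) : ℝ :=
  if p = ∞ then ⨆ i, ‖f i‖ else (∑ i, ‖f i‖ ^ p.toReal) ^ (1 / p.toReal)

variable {V R S : Type*} [Fintype V] [DecidableEq V] [Fintype R] [Fintype S]

/-- The multilinear forward Born operator: `bornK α0 B G C j` is `K_j`, mapping
`(η_1, …, η_j)` (given as the first `j` values of an `ℕ`-indexed family) to
`(r, s) ↦ (−α0)^j (B D_{η_1} G D_{η_2} G ⋯ G D_{η_j} C)(r, s)`; `K_0 := 0` is junk. -/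
noncomputable def bornK (α0 : ℝ) (B : Matrix R V ℂ) (G : Matrix V V ℂ) (C : Matrix V S ℂ) :
    ℕ → (ℕ → V → ℂ) → R × S → ℂ
  | 0, _ => 0
  | j + 1, η => fun rs =>
      (-(α0 : ℂ)) ^ (j + 1) *
        (B * Matrix.diagonal (η 0) *
          (List.ofFn fun i : Fin j => G * Matrix.diagonal (η (i.1 + 1))).prod * C) rs.1 rs.2

/-- `μ_p = α0 · max_{v ∈ V} ‖row v of G‖_{ℓ^q}` (this depends only on `q`). -/
noncomputable def muConst (α0 : ℝ) (q : ℝ≥0∞) (G : Matrix V V ℂ) : ℝ :=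
  α0 * ⨆ v : V, lpNorm q (G v)

/-- `ν_p = α0 · (Σ_{r ∈ R} ‖row r of B‖_q^p)^{1/p} · (Σ_{s ∈ S} ‖column s of C‖_q^p)^{1/p}`,
with maxima replacing sums when `p = ∞`. -/
noncomputable def nuConst (α0 : ℝ) (p q : ℝ≥0∞) (B : Matrix R V ℂ) (C : Matrix V S ℂ) : ℝ :=
  α0 * lpNorm p (fun r : R => lpNorm q (B r)) * lpNorm p (fun s : S => lpNorm q fun v => C v s)

/-- `C_p = min_{‖η‖_p = 1} ‖K_1 η‖_p`. -/
noncomputable def CpConst (p : ℝ≥0∞) (α0 : ℝ) (B : Matrix R V ℂ) (G : Matrix V V ℂ)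
    (C : Matrix V S ℂ) : ℝ :=
  sInf {t : ℝ | ∃ η : V → ℂ, lpNorm p η = 1 ∧ t = lpNorm p (bornK α0 B G C 1 fun _ => η)}


section LpNorm

variable {ι κ E : Type*} [Fintype ι] [Fintype κ] [SeminormedAddCommGroup E] {p q : ℝ≥0∞}

theorem lpNorm_eq_norm_toLp [hp : Fact (1 ≤ p)] (f : ι → E) :
    lpNorm p f = ‖WithLp.toLp p f‖ := by
  unfold lpNorm
  split_ifs with h
  · subst h
    rw [PiLp.norm_eq_ciSup]
  · rw [PiLp.norm_eq_sum (ENNReal.toReal_pos (zero_lt_one.trans_le hp.out).ne' h)]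

theorem lpNorm_nonneg (f : ι → E) : 0 ≤ lpNorm p f := by
  unfold lpNorm
  split_ifs
  · exact Real.iSup_nonneg fun i => norm_nonneg _
  · positivity

theorem lpNorm_mono {F : Type*} [SeminormedAddCommGroup F] {f : ι → E} {g : ι → F}
    (h : ∀ i, ‖f i‖ ≤ ‖g i‖) : lpNorm p f ≤ lpNorm p g := by
  unfold lpNorm
  split_ifs
  · exact ciSup_mono (Set.finite_range _).bddAbove h
  · gcongr with i
    exact h i

theorem norm_apply_le_lpNorm [Fact (1 ≤ p)] (f : ι → E) (i : ι) : ‖f i‖ ≤ lpNorm p f := by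
  rw [lpNorm_eq_norm_toLp]
  exact PiLp.norm_apply_le (WithLp.toLp p f) i

theorem lpNorm_const_mul [Fact (1 ≤ p)] {𝕜 : Type*} [NormedField 𝕜] (a : 𝕜) (f : ι → 𝕜) :
    lpNorm p (fun i => a * f i) = ‖a‖ * lpNorm p f := by
  rw [lpNorm_eq_norm_toLp, lpNorm_eq_norm_toLp, ← norm_smul]
  rfl

theorem lpNorm_mul_le_of_norm_le [Fact (1 ≤ p)] {𝕜 : Type*} [NormedField 𝕜] {f g : ι → 𝕜} {M : ℝ}
    (hg : ∀ i, ‖g i‖ ≤ M) : lpNorm p (fun i => f i * g i) ≤ lpNorm p f * M := by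
  have h : lpNorm p (fun i => f i * g i) ≤ lpNorm p fun i => M * ‖f i‖ := by
    refine lpNorm_mono fun i => ?_
    rw [norm_mul, norm_mul, norm_norm, mul_comm]
    gcongr
    exact (hg i).trans (Real.le_norm_self M)
  rcases isEmpty_or_nonempty ι with hι | ⟨⟨i⟩⟩
  · simp [lpNorm_eq_norm_toLp, Subsingleton.elim (WithLp.toLp p _) (0 : PiLp p fun _ : ι => 𝕜)]
  · have hM : 0 ≤ M := (norm_nonneg _).trans (hg i)
    rw [lpNorm_const_mul, Real.norm_of_nonneg hM, mul_comm] at h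
    exact h.trans (mul_le_mul_of_nonneg_right (lpNorm_mono fun i => (norm_norm (f i)).le) hM)

theorem norm_sum_mul_le_lpNorm_mul_lpNorm (hp : 1 ≤ p) (hq : 1 ≤ q) (hpq : 1 / p + 1 / q = 1)
    {𝕜 : Type*} [NormedField 𝕜] (f g : ι → 𝕜) :
    ‖∑ i, f i * g i‖ ≤ lpNorm q f * lpNorm p g := by
  have hfg : ‖∑ i, f i * g i‖ ≤ ∑ i, ‖f i‖ * ‖g i‖ :=
    (norm_sum_le _ _).trans (Finset.sum_le_sum fun i _ => norm_mul_le _ _)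
  refine hfg.trans ?_
  have := Fact.mk hp
  have := Fact.mk hq
  by_cases hp' : p = ∞
  · subst hp'
    obtain rfl : q = 1 := by simpa using hpq
    have : lpNorm 1 f = ∑ i, ‖f i‖ := by simp [lpNorm]
    rw [this, Finset.sum_mul]
    gcongr with i
    exact norm_apply_le_lpNorm g i
  by_cases hq' : q = ∞
  · subst hq'
    obtain rfl : p = 1 := by simpa using hpq
    have : lpNorm 1 g = ∑ i, ‖g i‖ := by simp [lpNorm]
    rw [this, Finset.mul_sum]
    gcongr with i
    exact norm_apply_le_lpNorm f i
  have hp0 : 0 < p.toReal := ENNReal.toReal_pos (zero_lt_one.trans_le hp).ne' hp'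
  have hq0 : 0 < q.toReal := ENNReal.toReal_pos (zero_lt_one.trans_le hq).ne' hq'
  have hconj : q.toReal.HolderConjugate p.toReal := by
    refine ⟨?_, hq0, hp0⟩
    have h := congrArg ENNReal.toReal hpq
    rw [ENNReal.toReal_add (by simp [(zero_lt_one.trans_le hp).ne'])
      (by simp [(zero_lt_one.trans_le hq).ne'])] at h
    simp only [one_div, ENNReal.toReal_inv, ENNReal.toReal_one] at h
    linarith
  simpa [lpNorm, hp', hq'] using
    Real.inner_le_Lp_mul_Lq Finset.univ (fun i => ‖f i‖) (fun i => ‖g i‖) hconj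

theorem lpNorm_prod_mul_le (hp : 1 ≤ p) {b : ι → ℝ} {c : κ → ℝ} :
    lpNorm p (fun x : ι × κ => b x.1 * c x.2) ≤ lpNorm p b * lpNorm p c := by
  have := Fact.mk hp
  by_cases h : p = ∞
  · subst h
    have hb : ∀ i, ‖b i‖ ≤ lpNorm ∞ b := norm_apply_le_lpNorm b
    have hc : ∀ i, ‖c i‖ ≤ lpNorm ∞ c := norm_apply_le_lpNorm c
    rw [lpNorm, if_pos rfl]
    refine Real.iSup_le (fun x => ?_) (mul_nonneg (lpNorm_nonneg b) (lpNorm_nonneg c))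
    rw [norm_mul]
    exact mul_le_mul (hb _) (hc _) (norm_nonneg _) (lpNorm_nonneg b)
  · simp only [lpNorm, if_neg h]
    rw [← Real.mul_rpow (by positivity) (by positivity), Fintype.sum_prod_type,
      Finset.sum_mul_sum]
    simp only [norm_mul]
    simp_rw [Real.mul_rpow (norm_nonneg _) (norm_nonneg _)]
    exact le_rfl

end LpNorm

/-- If `L` is surjective and expands distances by at least `c`, then a perturbation of `L` by a map
which is Lipschitz with constant `κ < c` on a ball is uniquely solvable there. -/
theorem existsUnique_add_eq_of_lipschitz {E F : Type*} [NormedAddCommGroup E] [CompleteSpace E]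
    [NormedAddCommGroup F] {L N : E → F} {φ : F} {c κ ρ R : ℝ} (hL : Function.Surjective L)
    (hL0 : L 0 = 0) (hLc : ∀ x y, c * ‖x - y‖ ≤ ‖L x - L y‖) (hκ : 0 ≤ κ) (hκc : κ < c)
    (hρ : 0 ≤ ρ) (hρR : ρ < R) (hN : ∀ x y, ‖x‖ ≤ ρ → ‖y‖ ≤ ρ → ‖N x - N y‖ ≤ κ * ‖x - y‖)
    (hmaps : ∀ x, ‖x‖ ≤ ρ → ‖φ - N x‖ ≤ c * ρ)
    (hball : ∀ x, ‖x‖ < R → L x + N x = φ → ‖x‖ ≤ ρ) :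
    ∃! x, ‖x‖ < R ∧ L x + N x = φ := by
  have hc : 0 < c := hκ.trans_lt hκc
  choose T hT using fun x => hL (φ - N x)
  have hTmaps : Set.MapsTo T (Metric.closedBall 0 ρ) (Metric.closedBall 0 ρ) := by
    intro x hx
    rw [mem_closedBall_zero_iff] at hx ⊢
    have h := hLc (T x) 0
    rw [hL0, sub_zero, sub_zero, hT] at h
    exact le_of_mul_le_mul_left (h.trans (hmaps x hx)) hc
  have hcontr : ContractingWith (κ / c).toNNReal (hTmaps.restrict T _ _) := by
    refine ⟨?_, LipschitzWith.of_dist_le_mul fun x y => ?_⟩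
    · rw [Real.toNNReal_lt_one]
      exact (div_lt_one hc).2 hκc
    · rw [Real.coe_toNNReal _ (by positivity), Subtype.dist_eq, Subtype.dist_eq,
        dist_eq_norm, dist_eq_norm, div_mul_eq_mul_div, le_div_iff₀ hc, mul_comm _ c]
      refine (hLc _ _).trans ?_
      simp only [Set.MapsTo.val_restrict_apply]
      rw [hT, hT, sub_sub_sub_cancel_left, norm_sub_rev]
      exact hN _ _ (mem_closedBall_zero_iff.1 x.2) (mem_closedBall_zero_iff.1 y.2)
  obtain ⟨x, hx, hfix, -⟩ := hcontr.exists_fixedPoint' Metric.isClosed_closedBall.isComplete hTmaps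
    (Metric.mem_closedBall_self hρ) (edist_ne_top _ _)
  refine ⟨x, ⟨(mem_closedBall_zero_iff.1 hx).trans_lt hρR, ?_⟩, ?_⟩
  · have h := hT x
    rw [hfix.eq] at h
    rw [h, sub_add_cancel]
  · rintro y ⟨hyR, hy⟩
    have hyρ := hball y hyR hy
    have hxy : L y - L x = N x - N y := by
      have h := hT x
      rw [hfix.eq] at h
      rw [h, ← hy]
      abel
    have h₁ := hLc y x
    rw [hxy] at h₁
    have h₂ := hN x y (mem_closedBall_zero_iff.1 hx) hyρ
    rw [norm_sub_rev x y] at h₂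
    have h₃ : ‖y - x‖ ≤ 0 := by nlinarith [norm_nonneg (y - x)]
    exact sub_eq_zero.1 (norm_le_zero_iff.1 h₃)


theorem norm_sum_mul_mul_le {ι 𝕜 : Type*} [Fintype ι] [NormedField 𝕜] {p q : ℝ≥0∞} (hp : 1 ≤ p)
    (hq : 1 ≤ q) (hpq : 1 / p + 1 / q = 1) (a η : ι → 𝕜) {y : ι → 𝕜} {M : ℝ}
    (hy : ∀ i, ‖y i‖ ≤ M) :
    ‖∑ i, a i * (η i * y i)‖ ≤ lpNorm q a * (lpNorm p η * M) := by
  have := Fact.mk hp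
  exact (norm_sum_mul_le_lpNorm_mul_lpNorm hp hq hpq a fun i => η i * y i).trans
    (mul_le_mul_of_nonneg_left (lpNorm_mul_le_of_norm_le hy) (lpNorm_nonneg a))

section Born

variable (α0 : ℝ) (B : Matrix R V ℂ) (G : Matrix V V ℂ) (C : Matrix V S ℂ) {p q : ℝ≥0∞}

omit [Fintype R] [Fintype S] in
theorem bornK_succ_apply (j : ℕ) (η : V → ℂ) (x : R × S) :
    bornK α0 B G C (j + 1) (fun _ => η) x = (-(α0 : ℂ)) ^ (j + 1) *
      ∑ v, B x.1 v * (η v * ((G * Matrix.diagonal η) ^ j * C) v x.2) := by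
  simp only [bornK, List.ofFn_const, List.prod_replicate]
  rw [Matrix.mul_assoc, Matrix.mul_apply]
  simp [Matrix.mul_diagonal, mul_assoc]

omit [Fintype S] in
theorem pow_succ_mul_apply (j : ℕ) (η : V → ℂ) (v : V) (s : S) :
    ((G * Matrix.diagonal η) ^ (j + 1) * C) v s =
      ∑ u, G v u * (η u * ((G * Matrix.diagonal η) ^ j * C) u s) := by
  rw [pow_succ', Matrix.mul_assoc, Matrix.mul_apply]
  simp [Matrix.mul_diagonal, mul_assoc]

omit [DecidableEq V] in
theorem lpNorm_row_le_iSup (v : V) : lpNorm q (G v) ≤ ⨆ v, lpNorm q (G v) :=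
  le_ciSup (f := fun v => lpNorm q (G v)) (Set.finite_range _).bddAbove v

omit [DecidableEq V] in
theorem iSup_lpNorm_row_nonneg : 0 ≤ ⨆ v, lpNorm q (G v) :=
  Real.iSup_nonneg fun _ => lpNorm_nonneg _

omit [Fintype S] in
theorem norm_pow_mul_apply_le (hp : 1 ≤ p) (hq : 1 ≤ q) (hpq : 1 / p + 1 / q = 1) {ρ : ℝ}
    {η : V → ℂ} (hη : lpNorm p η ≤ ρ) (j : ℕ) (v : V) (s : S) :
    ‖((G * Matrix.diagonal η) ^ j * C) v s‖ ≤
      ((⨆ v, lpNorm q (G v)) * ρ) ^ j * lpNorm q fun v => C v s := by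
  have := Fact.mk hq
  have hm : 0 ≤ ⨆ v, lpNorm q (G v) := iSup_lpNorm_row_nonneg G
  have hc : 0 ≤ lpNorm q fun v => C v s := lpNorm_nonneg _
  have hη0 : 0 ≤ lpNorm p η := lpNorm_nonneg _
  have hρ : 0 ≤ ρ := hη0.trans hη
  induction j generalizing v with
  | zero => simpa using norm_apply_le_lpNorm (p := q) (fun v => C v s) v
  | succ j ih =>
    rw [pow_succ_mul_apply]
    refine (norm_sum_mul_mul_le hp hq hpq (G v) η ih).trans ?_
    calc _ ≤ (⨆ v, lpNorm q (G v)) *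
          (ρ * (((⨆ v, lpNorm q (G v)) * ρ) ^ j * lpNorm q fun v => C v s)) := by
          gcongr
          exact lpNorm_row_le_iSup G v
      _ = _ := by ring

omit [Fintype S] in
theorem norm_pow_mul_apply_sub_le (hp : 1 ≤ p) (hq : 1 ≤ q) (hpq : 1 / p + 1 / q = 1) {ρ : ℝ}
    {η θ : V → ℂ} (hη : lpNorm p η ≤ ρ) (hθ : lpNorm p θ ≤ ρ) (j : ℕ) (v : V) (s : S) :
    ‖((G * Matrix.diagonal η) ^ j * C) v s - ((G * Matrix.diagonal θ) ^ j * C) v s‖ ≤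
      j * (⨆ v, lpNorm q (G v)) ^ j * ρ ^ (j - 1) * (lpNorm q fun v => C v s) *
        lpNorm p (η - θ) := by
  have := Fact.mk hq
  have hm : 0 ≤ ⨆ v, lpNorm q (G v) := iSup_lpNorm_row_nonneg G
  have hc : 0 ≤ lpNorm q fun v => C v s := lpNorm_nonneg _
  have hη0 : 0 ≤ lpNorm p η := lpNorm_nonneg _
  have hd : 0 ≤ lpNorm p (η - θ) := lpNorm_nonneg _
  have hρ : 0 ≤ ρ := hη0.trans hη
  induction j generalizing v with
  | zero => simp
  | succ j ih =>
    have hsplit : ((G * Matrix.diagonal η) ^ (j + 1) * C) v s -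
        ((G * Matrix.diagonal θ) ^ (j + 1) * C) v s =
        ∑ u, G v u * (η u * (((G * Matrix.diagonal η) ^ j * C) u s -
          ((G * Matrix.diagonal θ) ^ j * C) u s)) +
        ∑ u, G v u * ((η - θ) u * ((G * Matrix.diagonal θ) ^ j * C) u s) := by
      rw [pow_succ_mul_apply, pow_succ_mul_apply, ← Finset.sum_sub_distrib,
        ← Finset.sum_add_distrib]
      refine Finset.sum_congr rfl fun u _ => ?_
      rw [Pi.sub_apply]
      ring
    rw [hsplit]
    refine (norm_add_le_of_le (norm_sum_mul_mul_le hp hq hpq (G v) η ih)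
      (norm_sum_mul_mul_le hp hq hpq (G v) (η - θ)
        fun u => norm_pow_mul_apply_le G C hp hq hpq hθ j u s)).trans ?_
    have hpow : ρ * ((j : ℝ) * ρ ^ (j - 1)) = j * ρ ^ j := by
      cases j with
      | zero => simp
      | succ k => rw [Nat.add_sub_cancel, pow_succ]; ring
    have hrow := lpNorm_row_le_iSup (q := q) G v
    generalize (⨆ v, lpNorm q (G v)) = m at *
    generalize (lpNorm q fun v => C v s) = c at *
    generalize lpNorm p (η - θ) = d at *
    calc _ ≤ m * (ρ * (j * m ^ j * ρ ^ (j - 1) * c * d)) + m * (d * ((m * ρ) ^ j * c)) := by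
          gcongr
      _ = m ^ (j + 1) * c * d * (ρ * ((j : ℝ) * ρ ^ (j - 1))) +
            m ^ (j + 1) * c * d * ρ ^ j := by ring
      _ = _ := by
          rw [hpow, Nat.add_sub_cancel]
          push_cast
          ring

omit [DecidableEq V] in
theorem lpNorm_le_nuConst_mul (hα0 : 0 ≤ α0) (hp : 1 ≤ p) {f : R × S → ℂ} {M : ℝ} (hM : 0 ≤ M)
    (hf : ∀ x, ‖f x‖ ≤ α0 * M * (lpNorm q (B x.1) * lpNorm q fun v => C v x.2)) :
    lpNorm p f ≤ nuConst α0 p q B C * M := by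
  have := Fact.mk hp
  have hαM : 0 ≤ α0 * M := mul_nonneg hα0 hM
  calc lpNorm p f
      ≤ lpNorm p fun x : R × S => α0 * M * (lpNorm q (B x.1) * lpNorm q fun v => C v x.2) :=
        lpNorm_mono fun x => (hf x).trans (Real.le_norm_self _)
    _ ≤ α0 * M * (lpNorm p (fun r => lpNorm q (B r)) *
          lpNorm p fun s => lpNorm q fun v => C v s) := by
        rw [lpNorm_const_mul, Real.norm_of_nonneg hαM]
        exact mul_le_mul_of_nonneg_left (lpNorm_prod_mul_le hp (b := fun r => lpNorm q (B r))
          (c := fun s => lpNorm q fun v => C v s)) hαM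
    _ = nuConst α0 p q B C * M := by
        rw [nuConst]
        ring

theorem lpNorm_bornK_le (hα0 : 0 ≤ α0) (hp : 1 ≤ p) (hq : 1 ≤ q) (hpq : 1 / p + 1 / q = 1)
    {ρ : ℝ} {η : V → ℂ} (hη : lpNorm p η ≤ ρ) (j : ℕ) :
    lpNorm p (bornK α0 B G C (j + 1) fun _ => η) ≤
      nuConst α0 p q B C * ((muConst α0 q G * ρ) ^ j * ρ) := by
  have hm : 0 ≤ ⨆ v, lpNorm q (G v) := iSup_lpNorm_row_nonneg G
  have hρ : 0 ≤ ρ := (lpNorm_nonneg _).trans hη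
  have hμ : 0 ≤ muConst α0 q G := mul_nonneg hα0 hm
  refine lpNorm_le_nuConst_mul α0 B C hα0 hp (by positivity) fun x => ?_
  have hc : 0 ≤ lpNorm q fun v => C v x.2 := lpNorm_nonneg _
  have hb : 0 ≤ lpNorm q (B x.1) := lpNorm_nonneg _
  rw [bornK_succ_apply, norm_mul, norm_pow, norm_neg, Complex.norm_of_nonneg hα0]
  calc _ ≤ α0 ^ (j + 1) * (lpNorm q (B x.1) * (ρ * (((⨆ v, lpNorm q (G v)) * ρ) ^ j *
          lpNorm q fun v => C v x.2))) := by
        refine mul_le_mul_of_nonneg_left ((norm_sum_mul_mul_le hp hq hpq _ η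
          fun u => norm_pow_mul_apply_le G C hp hq hpq hη j u x.2).trans ?_) (by positivity)
        gcongr
    _ = _ := by
        rw [muConst]
        ring

theorem lpNorm_bornK_sub_le (hα0 : 0 ≤ α0) (hp : 1 ≤ p) (hq : 1 ≤ q) (hpq : 1 / p + 1 / q = 1)
    {ρ : ℝ} {η θ : V → ℂ} (hη : lpNorm p η ≤ ρ) (hθ : lpNorm p θ ≤ ρ) (j : ℕ) :
    lpNorm p ((bornK α0 B G C (j + 1) fun _ => η) - bornK α0 B G C (j + 1) fun _ => θ) ≤
      nuConst α0 p q B C * ((j + 1) * (muConst α0 q G * ρ) ^ j * lpNorm p (η - θ)) := by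
  have hm : 0 ≤ ⨆ v, lpNorm q (G v) := iSup_lpNorm_row_nonneg G
  have hρ : 0 ≤ ρ := (lpNorm_nonneg _).trans hη
  have hμ : 0 ≤ muConst α0 q G := mul_nonneg hα0 hm
  have hd : 0 ≤ lpNorm p (η - θ) := lpNorm_nonneg _
  refine lpNorm_le_nuConst_mul α0 B C hα0 hp (by positivity) fun x => ?_
  have hc : 0 ≤ lpNorm q fun v => C v x.2 := lpNorm_nonneg _
  have hb : 0 ≤ lpNorm q (B x.1) := lpNorm_nonneg _
  have hsplit : ((bornK α0 B G C (j + 1) fun _ => η) - bornK α0 B G C (j + 1) fun _ => θ) x =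
      (-(α0 : ℂ)) ^ (j + 1) *
        (∑ u, B x.1 u * (η u * (((G * Matrix.diagonal η) ^ j * C) u x.2 -
          ((G * Matrix.diagonal θ) ^ j * C) u x.2)) +
        ∑ u, B x.1 u * ((η - θ) u * ((G * Matrix.diagonal θ) ^ j * C) u x.2)) := by
    rw [Pi.sub_apply, bornK_succ_apply, bornK_succ_apply, ← mul_sub, ← Finset.sum_sub_distrib,
      ← Finset.sum_add_distrib]
    congr 1
    refine Finset.sum_congr rfl fun u _ => ?_
    rw [Pi.sub_apply]
    ring
  rw [hsplit, norm_mul, norm_pow, norm_neg, Complex.norm_of_nonneg hα0]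
  have hpow : ρ * ((j : ℝ) * ρ ^ (j - 1)) = j * ρ ^ j := by
    cases j with
    | zero => simp
    | succ k => rw [Nat.add_sub_cancel, pow_succ]; ring
  have hsum := norm_add_le_of_le
    (norm_sum_mul_mul_le hp hq hpq (B x.1) η
      fun u => norm_pow_mul_apply_sub_le G C hp hq hpq hη hθ j u x.2)
    (norm_sum_mul_mul_le hp hq hpq (B x.1) (η - θ)
      fun u => norm_pow_mul_apply_le G C hp hq hpq hθ j u x.2)
  refine (mul_le_mul_of_nonneg_left hsum (by positivity)).trans ?_
  rw [muConst]
  generalize (⨆ v, lpNorm q (G v)) = m at *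
  generalize (lpNorm q fun v => C v x.2) = c at *
  generalize lpNorm p (η - θ) = d at *
  generalize lpNorm q (B x.1) = b at *
  calc _ ≤ α0 ^ (j + 1) * (b * (ρ * (j * m ^ j * ρ ^ (j - 1) * c * d)) +
          b * (d * ((m * ρ) ^ j * c))) := by gcongr
    _ = α0 ^ (j + 1) * b * m ^ j * c * d * (ρ * ((j : ℝ) * ρ ^ (j - 1))) +
          α0 ^ (j + 1) * b * m ^ j * c * d * ρ ^ j := by ring
    _ = _ := by
        rw [hpow]
        ring

omit [Fintype R] [Fintype S] in
theorem bornK_one_sub (η θ : V → ℂ) :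
    (bornK α0 B G C 1 fun _ => η - θ) =
      (bornK α0 B G C 1 fun _ => η) - bornK α0 B G C 1 fun _ => θ := by
  ext x
  simp only [Pi.sub_apply, bornK_succ_apply α0 B G C 0, pow_zero, Matrix.one_mul, ← mul_sub,
    ← Finset.sum_sub_distrib, ← sub_mul]

omit [Fintype R] [Fintype S] in
theorem bornK_one_smul (a : ℂ) (η : V → ℂ) :
    (bornK α0 B G C 1 fun _ => fun v => a * η v) = fun x => a * bornK α0 B G C 1 (fun _ => η) x := by
  ext x
  simp only [bornK_succ_apply α0 B G C 0, pow_zero, Matrix.one_mul, Finset.mul_sum]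
  exact Finset.sum_congr rfl fun v _ => by ring

theorem CpConst_nonneg : 0 ≤ CpConst p α0 B G C := by
  refine Real.sInf_nonneg ?_
  rintro _ ⟨η, -, rfl⟩
  exact lpNorm_nonneg _

theorem CpConst_mul_le (hp : 1 ≤ p) (η : V → ℂ) :
    CpConst p α0 B G C * lpNorm p η ≤ lpNorm p (bornK α0 B G C 1 fun _ => η) := by
  have := Fact.mk hp
  rcases (lpNorm_nonneg (p := p) η).eq_or_lt with h | h
  · rw [← h, mul_zero]
    exact lpNorm_nonneg _
  have ha : ‖((lpNorm p η : ℂ))⁻¹‖ = (lpNorm p η)⁻¹ := by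
    rw [norm_inv, Complex.norm_of_nonneg h.le]
  have hle : CpConst p α0 B G C ≤ (lpNorm p η)⁻¹ * lpNorm p (bornK α0 B G C 1 fun _ => η) := by
    refine csInf_le ⟨0, ?_⟩ ⟨fun v => ((lpNorm p η : ℂ))⁻¹ * η v, ?_, ?_⟩
    · rintro _ ⟨θ, -, rfl⟩
      exact lpNorm_nonneg _
    · rw [lpNorm_const_mul, ha, inv_mul_cancel₀ h.ne']
    · rw [bornK_one_smul, lpNorm_const_mul, ha]
  rwa [inv_mul_eq_div, le_div_iff₀ h] at hle

end Born

theorem hasSum_add_two_mul_pow {y : ℝ} (hy : 0 ≤ y) (hy1 : y < 1) :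
    HasSum (fun j : ℕ => (((j + 1 : ℕ) : ℝ) + 1) * y ^ (j + 1)) (1 / (1 - y) ^ 2 - 1) := by
  have hy' : ‖y‖ < 1 := by rwa [Real.norm_of_nonneg hy]
  have h := (hasSum_coe_mul_geometric_of_norm_lt_one hy').add (hasSum_geometric_of_lt_one hy hy1)
  have h' : HasSum (fun j : ℕ => ((j : ℝ) + 1) * y ^ j) (1 / (1 - y) ^ 2) := by
    have hterm : (fun j : ℕ => ((j : ℝ) + 1) * y ^ j) = fun j : ℕ => j * y ^ j + y ^ j := by
      ext j
      ring
    have hval : 1 / (1 - y) ^ 2 = y / (1 - y) ^ 2 + (1 - y)⁻¹ := by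
      have : 1 - y ≠ 0 := (sub_pos.2 hy1).ne'
      field_simp
      ring
    rw [hterm, hval]
    exact h
  simpa using (hasSum_nat_add_iff' 1).2 h'

/-- The scalar equation `c ρ = t + ν μ ρ² / (1 - μ ρ)` majorizing a perturbed linear equation: if
its right side is smaller than the left one at `R`, then it has a root below `R` at which the right
side has slope less than `c`, and all points of `[0, R]` where the left side does not exceed the
right one lie below that root. -/
theorem exists_majorant_root {c μ ν R t : ℝ} (hμ : 0 < μ) (hν : 0 ≤ ν) (hR : 0 < R)
    (hμR : μ * R < 1) (ht : 0 ≤ t) (hlt : t + ν * (μ * R ^ 2 / (1 - μ * R)) < c * R) :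
    ∃ ρ, 0 ≤ ρ ∧ ρ < R ∧ t + ν * (μ * ρ ^ 2 / (1 - μ * ρ)) = c * ρ ∧
      ν * (1 / (1 - μ * ρ) ^ 2 - 1) < c ∧
      ∀ σ, 0 ≤ σ → σ < R → c * σ ≤ t + ν * (μ * σ ^ 2 / (1 - μ * σ)) → σ ≤ ρ := by
  have hpos : ∀ σ ≤ R, 0 < 1 - μ * σ := fun σ hσ =>
    sub_pos.2 ((mul_le_mul_of_nonneg_left hσ hμ.le).trans_lt hμR)
  have hcont : ContinuousOn (fun ρ => c * ρ - (t + ν * (μ * ρ ^ 2 / (1 - μ * ρ)))) (Set.Icc 0 R) := by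
    refine ContinuousOn.sub (by fun_prop) (ContinuousOn.add (by fun_prop)
      (ContinuousOn.mul (by fun_prop) (ContinuousOn.div (by fun_prop) (by fun_prop) ?_)))
    exact fun σ hσ => (hpos σ hσ.2).ne'
  obtain ⟨ρ, ⟨hρ0, hρR⟩, hρ⟩ := intermediate_value_Icc hR.le hcont
    (show (0 : ℝ) ∈ Set.Icc _ _ from ⟨by simpa using ht, by linarith⟩)
  have hρ' : t + ν * (μ * ρ ^ 2 / (1 - μ * ρ)) = c * ρ := by
    simp only at hρ
    linarith
  have hlt' : ρ < R := lt_of_le_of_ne hρR fun h => by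
    subst h
    linarith
  have ha := hpos ρ hρR
  have hb := hpos R le_rfl
  refine ⟨ρ, hρ0, hlt', hρ', ?_, ?_⟩
  · have hconv : ν * (1 / (1 - μ * ρ) ^ 2 - 1) * (R - ρ) ≤
        ν * (μ * R ^ 2 / (1 - μ * R)) - ν * (μ * ρ ^ 2 / (1 - μ * ρ)) := by
      have : ν * (μ * R ^ 2 / (1 - μ * R)) - ν * (μ * ρ ^ 2 / (1 - μ * ρ)) -
          ν * (1 / (1 - μ * ρ) ^ 2 - 1) * (R - ρ) =
          ν * (μ * (R - ρ) ^ 2 / ((1 - μ * R) * (1 - μ * ρ) ^ 2)) := by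
        field_simp
        ring
      have h' : 0 ≤ ν * (μ * (R - ρ) ^ 2 / ((1 - μ * R) * (1 - μ * ρ) ^ 2)) := by positivity
      linarith
    nlinarith
  · intro σ hσ0 hσR hσ
    by_contra! hlt''
    have hs := hpos σ hσR.le
    have hconv : (ν * (μ * σ ^ 2 / (1 - μ * σ))) * (R - ρ) ≤
        ν * (μ * ρ ^ 2 / (1 - μ * ρ)) * (R - σ) + ν * (μ * R ^ 2 / (1 - μ * R)) * (σ - ρ) := by
      have : ν * (μ * ρ ^ 2 / (1 - μ * ρ)) * (R - σ) + ν * (μ * R ^ 2 / (1 - μ * R)) * (σ - ρ) -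
          (ν * (μ * σ ^ 2 / (1 - μ * σ))) * (R - ρ) =
          ν * (μ * (R - ρ) * (R - σ) * (σ - ρ) /
            ((1 - μ * R) * (1 - μ * σ) * (1 - μ * ρ))) := by
        field_simp
        ring
      have h₁ := sub_pos.2 hlt'
      have h₂ := sub_pos.2 hσR
      have h₃ := sub_pos.2 hlt''
      have h' : 0 ≤ ν * (μ * (R - ρ) * (R - σ) * (σ - ρ) /
            ((1 - μ * R) * (1 - μ * σ) * (1 - μ * ρ))) := by positivity
      linarith
    generalize ν * (μ * σ ^ 2 / (1 - μ * σ)) = hσ' at *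
    generalize ν * (μ * ρ ^ 2 / (1 - μ * ρ)) = hρ'' at *
    generalize ν * (μ * R ^ 2 / (1 - μ * R)) = hR' at *
    have e₁ : hρ'' = c * ρ - t := by linarith
    have e₂ : 0 < (c * R - t - hR') * (σ - ρ) :=
      mul_pos (by linarith) (sub_pos.2 hlt'')
    have e₃ : (c * σ - t) * (R - ρ) ≤ hσ' * (R - ρ) :=
      mul_le_mul_of_nonneg_right (by linarith) (sub_pos.2 hlt').le
    rw [e₁] at hconv
    nlinarith

/-- Unique solvability of `∑ⱼ kⱼ x = φ` in a ball, where `k₀` is surjective and expanding and the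
`kⱼ` obey the estimates of homogeneous polynomials of degree `j + 1` with norms `ν μ ^ j`. -/
theorem existsUnique_tsum_eq {E F : Type*} [NormedAddCommGroup E] [CompleteSpace E]
    [NormedAddCommGroup F] [CompleteSpace F] {k : ℕ → E → F} {φ : F} {c μ ν R : ℝ}
    (hsurj : Function.Surjective (k 0)) (hk0 : k 0 0 = 0)
    (hc : ∀ x y, c * ‖x - y‖ ≤ ‖k 0 x - k 0 y‖)
    (hμ : 0 < μ) (hν : 0 ≤ ν) (hR : 0 < R) (hμR : μ * R < 1)
    (hk : ∀ ρ x j, ‖x‖ ≤ ρ → ‖k j x‖ ≤ ν * ((μ * ρ) ^ j * ρ))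
    (hksub : ∀ ρ x y j, ‖x‖ ≤ ρ → ‖y‖ ≤ ρ →
      ‖k j x - k j y‖ ≤ ν * ((j + 1) * (μ * ρ) ^ j * ‖x - y‖))
    (hφ : ‖φ‖ + ν * (μ * R ^ 2 / (1 - μ * R)) < c * R) :
    ∃! x, ‖x‖ < R ∧ ∑' j, k j x = φ := by
  obtain ⟨ρ, hρ0, hρR, hρ, hslope, hroot⟩ :=
    exists_majorant_root hμ hν hR hμR (norm_nonneg φ) hφ
  have hlt : ∀ σ ≤ R, μ * σ < 1 := fun σ hσ =>
    (mul_le_mul_of_nonneg_left hσ hμ.le).trans_lt hμR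
  have htail : ∀ σ, 0 ≤ σ → σ ≤ R → HasSum (fun j : ℕ => ν * ((μ * σ) ^ (j + 1) * σ))
      (ν * (μ * σ ^ 2 / (1 - μ * σ))) := by
    intro σ hσ0 hσR
    have hterm : (fun j : ℕ => ν * ((μ * σ) ^ (j + 1) * σ)) =
        fun j : ℕ => ν * (μ * σ ^ 2) * (μ * σ) ^ j := by
      ext j
      ring
    rw [hterm, ← mul_div_assoc, div_eq_mul_inv]
    exact (hasSum_geometric_of_lt_one (mul_nonneg hμ.le hσ0) (hlt σ hσR)).mul_left _
  have hsummable : ∀ x, ‖x‖ ≤ R → Summable fun j => k (j + 1) x := fun x hx =>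
    .of_norm_bounded (htail ‖x‖ (norm_nonneg x) hx).summable fun j => hk ‖x‖ x (j + 1) le_rfl
  have hNle : ∀ σ x, ‖x‖ ≤ σ → σ ≤ R →
      ‖∑' j, k (j + 1) x‖ ≤ ν * (μ * σ ^ 2 / (1 - μ * σ)) := fun σ x hx hσ =>
    tsum_of_norm_bounded (htail σ ((norm_nonneg x).trans hx) hσ) fun j => hk σ x (j + 1) hx
  have hy0 : 0 ≤ μ * ρ := mul_nonneg hμ.le hρ0
  have hy1 := hlt ρ hρR.le
  have hκ : 0 ≤ ν * (1 / (1 - μ * ρ) ^ 2 - 1) :=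
    mul_nonneg hν ((hasSum_add_two_mul_pow hy0 hy1).nonneg fun j => by positivity)
  have huniq : ∃! x, ‖x‖ < R ∧ k 0 x + ∑' j, k (j + 1) x = φ := by
    refine existsUnique_add_eq_of_lipschitz (N := fun x => ∑' j, k (j + 1) x) hsurj hk0 hc hκ hslope
      hρ0 hρR ?_ ?_ ?_
    · intro x y hx hy
      rw [← (hsummable x (hx.trans hρR.le)).tsum_sub (hsummable y (hy.trans hρR.le))]
      refine tsum_of_norm_bounded
        (((hasSum_add_two_mul_pow hy0 hy1).mul_left ν).mul_right ‖x - y‖) fun j => ?_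
      refine (hksub ρ x y (j + 1) hx hy).trans_eq ?_
      ring
    · intro x hx
      rw [← hρ]
      exact (norm_sub_le _ _).trans (by gcongr; exact hNle ρ x hx hρR.le)
    · intro x hx hsol
      refine hroot ‖x‖ (norm_nonneg x) hx ?_
      have h := hc x 0
      rw [hk0, sub_zero, sub_zero, eq_sub_of_add_eq hsol] at h
      exact h.trans ((norm_sub_le _ _).trans (by gcongr; exact hNle ‖x‖ x le_rfl hx.le))
  refine (existsUnique_congr fun x => and_congr_right fun hx => ?_).2 huniq
  rw [((summable_nat_add_iff 1).1 (hsummable x hx.le)).tsum_eq_zero_add]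

/- STATEMENT 7: If `|V| = |R × S|`, `K_1` is invertible, `λ ≥ 1`,
`R_λ = (1/μ_p)·C_p/(C_p + ν_p λ)` and `r_{p,λ} = R_λ C_p (1 − 1/λ)`, then for every
`φ ∈ ℂ^{R×S}` with `‖φ‖_p < r_{p,λ}` there is exactly one `η` with `‖η‖_p < R_λ` and
`Σ_{j=1}^∞ K_j(η, …, η) = φ`. -/
theorem forward_born_unique_solution [Nonempty V] [Nonempty R] [Nonempty S]
    (p q : ℝ≥0∞) (hp : 1 ≤ p) (hq : 1 ≤ q) (hpq : 1 / p + 1 / q = 1)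
    (α0 : ℝ) (hα0 : 0 < α0) (B : Matrix R V ℂ) (G : Matrix V V ℂ) (C : Matrix V S ℂ)
    (hcard : Fintype.card V = Fintype.card (R × S))
    (hinv : Function.Bijective fun η : V → ℂ => bornK α0 B G C 1 fun _ => η)
    (lam : ℝ) (hlam : 1 ≤ lam)
    (Rlam rlam : ℝ)
    (hRlam : Rlam =
      1 / muConst α0 q G * (CpConst p α0 B G C / (CpConst p α0 B G C + nuConst α0 p q B C * lam)))
    (hrlam : rlam = Rlam * CpConst p α0 B G C * (1 - 1 / lam))
    (φ : R × S → ℂ) (hφ : lpNorm p φ < rlam) :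
    ∃! η : V → ℂ, lpNorm p η < Rlam ∧ (∑' j : ℕ, bornK α0 B G C (j + 1) fun _ => η) = φ := by
  have := Fact.mk hp
  set c := CpConst p α0 B G C
  set μ := muConst α0 q G
  set ν := nuConst α0 p q B C
  have hc0 : 0 ≤ c := CpConst_nonneg α0 B G C
  have hμ0 : 0 ≤ μ := mul_nonneg hα0.le (iSup_lpNorm_row_nonneg G)
  have hr : 0 < rlam := (lpNorm_nonneg φ).trans_lt hφ
  have hc : 0 < c := hc0.lt_of_ne fun h => by
    rw [hrlam, ← h] at hr
    simp at hr
  have hμ : 0 < μ := hμ0.lt_of_ne fun h => by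
    rw [hrlam, hRlam, ← h] at hr
    simp at hr
  have hlam0 : 0 < lam := zero_lt_one.trans_le hlam
  have hcν : c ≤ ν := by
    have h1 : 0 < lpNorm p fun _ : V => (1 : ℂ) :=
      zero_lt_one.trans_le (by
        simpa using norm_apply_le_lpNorm (p := p) (fun _ : V => (1 : ℂ)) (Classical.arbitrary V))
    refine le_of_mul_le_mul_right ((CpConst_mul_le α0 B G C hp _).trans ?_) h1
    simpa using lpNorm_bornK_le α0 B G C hα0.le hp hq hpq (le_refl (lpNorm p fun _ : V => (1 : ℂ))) 0
  have hν : 0 < ν := hc.trans_le hcν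
  have hR : 0 < Rlam := by
    rw [hRlam]
    positivity
  have hμR : μ * Rlam = c / (c + ν * lam) := by
    rw [hRlam]
    field_simp
  have hμR1 : μ * Rlam < 1 := by
    rw [hμR, div_lt_one (by positivity)]
    linarith [mul_pos hν hlam0]
  have hmaj : ν * (μ * Rlam ^ 2 / (1 - μ * Rlam)) = Rlam * c / lam := by
    have h : 1 - μ * Rlam = ν * lam / (c + ν * lam) := by
      rw [hμR]
      field_simp
      ring
    rw [show μ * Rlam ^ 2 = μ * Rlam * Rlam by ring, h, hμR]
    field_simp
  let e := PiLp.continuousLinearEquiv p ℂ fun _ : R × S => ℂ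
  have huniq := existsUnique_tsum_eq (E := PiLp p fun _ : V => ℂ) (F := PiLp p fun _ : R × S => ℂ)
    (k := fun j x => WithLp.toLp p (bornK α0 B G C (j + 1) fun _ => x.ofLp))
    (φ := WithLp.toLp p φ) (c := c) (μ := μ) (ν := ν) (R := Rlam) ?_ ?_ ?_ hμ hν.le hR hμR1 ?_ ?_ ?_
  · have hiff : ∀ η : V → ℂ, (lpNorm p η < Rlam ∧
        (∑' j : ℕ, bornK α0 B G C (j + 1) fun _ => η) = φ) ↔
        (‖WithLp.toLp p η‖ < Rlam ∧
          ∑' j, WithLp.toLp p (bornK α0 B G C (j + 1) fun _ => η) = WithLp.toLp p φ) := by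
      intro η
      have hsum : ∑' j, WithLp.toLp p (bornK α0 B G C (j + 1) fun _ => η) =
          WithLp.toLp p (∑' j : ℕ, bornK α0 B G C (j + 1) fun _ => η) :=
        (e.symm.map_tsum).symm
      rw [lpNorm_eq_norm_toLp, hsum, (WithLp.toLp_injective p).eq_iff]
    obtain ⟨x, hx, hx'⟩ := huniq
    exact ⟨x.ofLp, (hiff _).2 hx, fun η hη =>
      congrArg WithLp.ofLp (hx' (WithLp.toLp p η) ((hiff η).1 hη))⟩
  · intro y
    obtain ⟨η, hη⟩ := hinv.2 y.ofLp
    exact ⟨WithLp.toLp p η, congrArg (WithLp.toLp p) hη⟩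
  · have h := bornK_one_sub α0 B G C 0 0
    rw [sub_self, sub_self] at h
    exact congrArg (WithLp.toLp p) h
  · intro x y
    have h := CpConst_mul_le α0 B G C hp (x.ofLp - y.ofLp)
    rw [bornK_one_sub, lpNorm_eq_norm_toLp, lpNorm_eq_norm_toLp] at h
    exact h
  · intro ρ x j hx
    have h := lpNorm_bornK_le α0 B G C hα0.le hp hq hpq (ρ := ρ) (η := x.ofLp)
      (by rwa [lpNorm_eq_norm_toLp]) j
    rwa [lpNorm_eq_norm_toLp] at h
  · intro ρ x y j hx hy
    have h := lpNorm_bornK_sub_le α0 B G C hα0.le hp hq hpq (ρ := ρ) (η := x.ofLp) (θ := y.ofLp)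
      (by rwa [lpNorm_eq_norm_toLp]) (by rwa [lpNorm_eq_norm_toLp]) j
    rw [lpNorm_eq_norm_toLp, lpNorm_eq_norm_toLp] at h
    exact h
  · rw [lpNorm_eq_norm_toLp, hrlam] at hφ
    rw [hmaj]
    calc _ < Rlam * c * (1 - 1 / lam) + Rlam * c / lam := by gcongr
      _ = c * Rlam := by ring
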